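/- There exists a cyclic code C ⊆ G_2(8,4) with minimum subspace distance at least 4 and |C| = 4420, consisting of 16 orbits of cardinality 255 and 4 orbits of cardinality 85. -/

import Mathlib

open Module

/-- The cyclic shift `αV = {αv : v ∈ V}` of an `Fq`-subspace `V` of the extension field `F`
by a field element `α`. -/
def cyclicShift (Fq F : Type*) [Field Fq] [Field F] [Algebra Fq F]
    (α : F) (V : Submodule Fq F) : Submodule Fq F :=
  Submodule.map (LinearMap.mulLeft Fq α) V

/-- The subspace distance `d(U,W) = dim U + dim W − 2 dim (U ∩ W)`. -/
noncomputable def subspaceDist (Fq F : Type*) [Field Fq] [Field F] [Algebra Fq F]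
    (U W : Submodule Fq F) : ℕ :=
  finrank Fq U + finrank Fq W - 2 * finrank Fq ↥(U ⊓ W)

/-- `C` is a cyclic code in the Grassmannian `G_q(n,k)` (all members have dimension `k`,
and `C` is closed under cyclic shifts by nonzero field elements) with minimum subspace
distance at least `d`. -/
def IsCyclicCode (Fq F : Type*) [Field Fq] [Field F] [Algebra Fq F]
    (k d : ℕ) (C : Set (Submodule Fq F)) : Prop :=
  (∀ U ∈ C, finrank Fq U = k) ∧
  (∀ α : F, α ≠ 0 → ∀ U ∈ C, cyclicShift Fq F α U ∈ C) ∧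
  (∀ U ∈ C, ∀ W ∈ C, U ≠ W → d ≤ subspaceDist Fq F U W)

/-- The orbit `orb(V) = {αV : α ∈ F, α ≠ 0}` of a subspace `V`. -/
def orbitOf (Fq F : Type*) [Field Fq] [Field F] [Algebra Fq F]
    (V : Submodule Fq F) : Set (Submodule Fq F) :=
  {W | ∃ α : F, α ≠ 0 ∧ W = cyclicShift Fq F α V}

/-- The set of orbits of members of a code `C`. -/
def orbitsOf (Fq F : Type*) [Field Fq] [Field F] [Algebra Fq F]
    (C : Set (Submodule Fq F)) : Set (Set (Submodule Fq F)) :=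
  {O | ∃ V ∈ C, O = orbitOf Fq F V}

/-- Exponents of the nonzero elements of representatives of the orbits, relative to a root of
`X ^ 8 + X ^ 4 + X ^ 3 + X ^ 2 + 1`. -/
def codeLogs : Fin 20 → List ℕ := ![
  [0, 1, 25, 30, 37, 53, 66, 142, 147, 152, 163, 179, 182, 218, 226],
  [0, 1, 11, 22, 25, 54, 57, 60, 83, 132, 148, 206, 208, 235, 245],
  [0, 2, 9, 22, 41, 44, 50, 108, 114, 120, 157, 161, 166, 215, 235],
  [0, 1, 13, 25, 40, 44, 58, 84, 99, 107, 117, 122, 128, 140, 215],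
  [0, 1, 2, 25, 26, 50, 80, 88, 116, 168, 175, 198, 214, 234, 244],
  [0, 1, 23, 25, 27, 73, 75, 104, 118, 123, 164, 183, 196, 199, 236],
  [0, 2, 46, 50, 54, 73, 111, 137, 143, 146, 150, 208, 217, 236, 246],
  [0, 4, 19, 31, 37, 45, 92, 100, 108, 146, 161, 179, 217, 222, 237],
  [0, 4, 11, 16, 20, 42, 56, 100, 116, 131, 145, 149, 188, 214, 245],
  [0, 1, 15, 25, 28, 33, 36, 77, 105, 114, 166, 193, 225, 228, 248],
  [0, 2, 30, 50, 56, 66, 72, 77, 131, 154, 195, 201, 210, 228, 241],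
  [0, 3, 10, 21, 57, 83, 111, 115, 118, 164, 171, 211, 223, 243, 246],
  [0, 1, 6, 7, 25, 31, 45, 67, 98, 112, 139, 191, 192, 216, 247],
  [0, 2, 7, 50, 69, 97, 112, 128, 130, 140, 142, 151, 178, 190, 218],
  [0, 1, 4, 5, 14, 25, 29, 47, 100, 101, 125, 138, 181, 194, 224],
  [0, 2, 8, 10, 21, 28, 50, 58, 94, 107, 133, 193, 200, 202, 250],
  [0, 4, 15, 33, 79, 85, 89, 100, 118, 164, 170, 174, 185, 203, 249],
  [0, 7, 19, 27, 49, 85, 92, 104, 112, 134, 170, 177, 189, 197, 219],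
  [0, 1, 25, 41, 72, 85, 86, 110, 126, 157, 170, 171, 195, 211, 242],
  [0, 2, 50, 59, 82, 85, 87, 135, 144, 167, 170, 172, 220, 229, 252]]

/-- Multiplication by `X` modulo `X ^ 8 + X ^ 4 + X ^ 3 + X ^ 2 + 1` over the field with two
elements, on coefficient vectors packed into natural numbers. -/
def mulX (n : ℕ) : ℕ := if n < 128 then 2 * n else (2 * n) ^^^ 285

/-- The packed coefficient vector of `X ^ k`. -/
def powX : ℕ → ℕ
  | 0 => 1
  | k + 1 => mulX (powX k)

/-- The period of each orbit. -/
def codePeriod (i : Fin 20) : ℕ := if i.1 < 16 then 255 else 85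

/-- Two consecutive periods of the indicator bit vector of a set of exponents modulo `255`. -/
def unroll (L : List ℕ) : ℕ := L.foldr (fun l a => a ||| (2 ^ l ||| 2 ^ (l + 255))) 0

/-- Bit `k < 255` is set when bit `l + k` of `D` is set for at least `m` entries `l` of the list. -/
def atLeast (D : ℕ) : ℕ → List ℕ → ℕ
  | 0, _ => 2 ^ 255 - 1
  | _ + 1, [] => 0
  | m + 1, l :: L => atLeast D (m + 1) L ||| (atLeast D m L &&& (D >>> l))

theorem mulX_lt : ∀ n < 256, mulX n < 256 := by decide +kernel

theorem codeLogs_lt : ∀ i, ∀ l ∈ codeLogs i, l < 255 := by decide +kernel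

theorem codeLogs_nodup : ∀ i, (codeLogs i).Nodup := by decide +kernel

theorem codeLogs_length : ∀ i, (codeLogs i).length = 15 := by decide +kernel

theorem codeLogs_add : ∀ i, ∀ l ∈ codeLogs i, ∀ m ∈ codeLogs i,
    powX l ^^^ powX m = 0 ∨ ∃ k ∈ codeLogs i, powX k = powX l ^^^ powX m := by decide +kernel

theorem codeLogs_periodic : ∀ i, ∀ l ∈ codeLogs i, (l + codePeriod i) % 255 ∈ codeLogs i := by
  decide +kernel

/-- The bits below `255` at multiples of the period of the `i`-th orbit. -/
def periodMask (i : Fin 20) : ℕ := if i.1 < 16 then 1 else 2 ^ 170 + 2 ^ 85 + 1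

theorem dvd_of_testBit_periodMask : ∀ i, ∀ m < 255, (periodMask i).testBit m = true →
    codePeriod i ∣ m := by
  decide +kernel

theorem codeLogs_overlap : ∀ i j, atLeast (unroll (codeLogs j)) 4 (codeLogs i) =
    if i = j then periodMask i else 0 := by
  decide +kernel

section BinaryRoot

variable {F : Type*} [Field F] {b : F}

/-- The value at `b` of the polynomial of degree at most `8` with packed coefficient vector `n`. -/
def bitEval (b : F) (n : ℕ) : F := ∑ i ∈ Finset.range 9, if n.testBit i then b ^ i else 0


theorem bitEval_xor [CharP F 2] (b : F) (m n : ℕ) :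
    bitEval b (m ^^^ n) = bitEval b m + bitEval b n := by
  simp only [bitEval, ← Finset.sum_add_distrib, Nat.testBit_xor]
  refine Finset.sum_congr rfl fun i _ => ?_
  cases m.testBit i <;> cases n.testBit i <;> simp [CharTwo.add_self_eq_zero]

theorem bitEval_two_mul (b : F) {n : ℕ} (hn : n < 256) : bitEval b (2 * n) = b * bitEval b n := by
  have h8 : n.testBit 8 = false := Nat.testBit_lt_two_pow hn
  rw [bitEval, bitEval, Finset.sum_range_succ', Finset.sum_range_succ _ 8]
  simp [h8, Nat.testBit_succ, Finset.mul_sum, pow_succ']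

theorem bitEval_modulus (hb : b ^ 8 + b ^ 4 + b ^ 3 + b ^ 2 + 1 = 0) : bitEval b 285 = 0 := by
  rw [← hb]
  simp [bitEval, Finset.sum_range_succ, Nat.testBit]
  ring

theorem bitEval_mulX [CharP F 2] (hb : b ^ 8 + b ^ 4 + b ^ 3 + b ^ 2 + 1 = 0)
    {n : ℕ} (hn : n < 256) :
    bitEval b (mulX n) = b * bitEval b n := by
  unfold mulX
  split_ifs
  · exact bitEval_two_mul b hn
  · rw [bitEval_xor, bitEval_modulus hb, add_zero, bitEval_two_mul b hn]

theorem powX_lt (k : ℕ) : powX k < 256 := by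
  induction k with
  | zero => simp [powX]
  | succ k ih => exact mulX_lt _ ih

theorem bitEval_powX [CharP F 2] (hb : b ^ 8 + b ^ 4 + b ^ 3 + b ^ 2 + 1 = 0) (k : ℕ) :
    bitEval b (powX k) = b ^ k := by
  induction k with
  | zero => simp [powX, bitEval, Finset.sum_range_succ, Nat.testBit]
  | succ k ih => rw [powX, bitEval_mulX hb (powX_lt k), ih, pow_succ']

theorem pow_add_pow_eq_of_powX_xor [CharP F 2] (hb : b ^ 8 + b ^ 4 + b ^ 3 + b ^ 2 + 1 = 0)
    {k l m : ℕ}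
    (h : powX k = powX l ^^^ powX m) : b ^ l + b ^ m = b ^ k := by
  rw [← bitEval_powX hb, ← bitEval_powX hb, ← bitEval_powX hb, h, bitEval_xor]

theorem ne_zero_of_root (hb : b ^ 8 + b ^ 4 + b ^ 3 + b ^ 2 + 1 = 0) : b ≠ 0 := by
  rintro rfl
  simp at hb

theorem pow_ne_one_of_powX_xor [CharP F 2] (hb : b ^ 8 + b ^ 4 + b ^ 3 + b ^ 2 + 1 = 0) {k l : ℕ}
    (h : powX k = powX l ^^^ powX 0) : b ^ l ≠ 1 := by
  intro hl
  have := pow_add_pow_eq_of_powX_xor hb h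
  rw [hl, pow_zero, CharTwo.add_self_eq_zero] at this
  exact pow_ne_zero _ (ne_zero_of_root hb) this.symm

theorem orderOf_root [CharP F 2] (hb : b ^ 8 + b ^ 4 + b ^ 3 + b ^ 2 + 1 = 0) : orderOf b = 255 := by
  refine orderOf_eq_of_pow_and_pow_div_prime (by norm_num) ?_ fun p hp hdvd => ?_
  · rw [← bitEval_powX hb, ← pow_zero b, ← bitEval_powX hb]
    exact congrArg _ (by decide +kernel)
  · have hmem : p ∈ Nat.primeFactors 255 := Nat.mem_primeFactors.2 ⟨hp, hdvd, by norm_num⟩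
    rw [show Nat.primeFactors 255 = {3, 5, 17} by decide +kernel] at hmem
    have h : ∀ p ∈ ({3, 5, 17} : Finset ℕ), ∃ k < 255, powX k = powX (255 / p) ^^^ powX 0 := by
      decide +kernel
    obtain ⟨k, -, hk⟩ := h p hmem
    exact pow_ne_one_of_powX_xor hb hk

theorem exists_pow_eq_of_root [CharP F 2] [Finite F] (hF : Nat.card F = 256)
    (hb : b ^ 8 + b ^ 4 + b ^ 3 + b ^ 2 + 1 = 0) {y : F} (hy : y ≠ 0) :
    ∃ k < 255, b ^ k = y := by
  classical
  have := Fintype.ofFinite F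
  have hinj : Set.InjOn (fun k => b ^ k) (Finset.range 255 : Set ℕ) := by
    have := pow_injOn_Iio_orderOf (x := b)
    rwa [orderOf_root hb, ← Finset.coe_Iio, Nat.Iio_eq_range] at this
  have hsub : (Finset.range 255).image (fun k => b ^ k) ⊆ Finset.univ.erase 0 := by
    intro z hz
    obtain ⟨k, -, rfl⟩ := Finset.mem_image.1 hz
    exact Finset.mem_erase.2 ⟨pow_ne_zero _ (ne_zero_of_root hb), Finset.mem_univ _⟩
  have heq := Finset.eq_of_subset_of_card_le hsub (by
    rw [Finset.card_image_of_injOn hinj, Finset.card_erase_of_mem (Finset.mem_univ _),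
      Finset.card_univ, ← Nat.card_eq_fintype_card, hF, Finset.card_range])
  have hmem : y ∈ (Finset.range 255).image (fun k => b ^ k) := by
    rw [heq]
    exact Finset.mem_erase.2 ⟨hy, Finset.mem_univ _⟩
  simpa using hmem

theorem exists_root_of_card [CharP F 2] [Finite F] (hF : Nat.card F = 256) :
    ∃ b : F, b ^ 8 + b ^ 4 + b ^ 3 + b ^ 2 + 1 = 0 := by
  have := Fintype.ofFinite F
  let K := AlgebraicClosure F
  have : CharP K 2 := charP_of_injective_algebraMap (algebraMap F K).injective 2
  obtain ⟨c, hc⟩ := IsAlgClosed.exists_root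
    (Polynomial.X ^ 8 + Polynomial.X ^ 4 + Polynomial.X ^ 3 + Polynomial.X ^ 2 + 1 :
      Polynomial K) (by
    have : (Polynomial.X ^ 8 + Polynomial.X ^ 4 + Polynomial.X ^ 3 + Polynomial.X ^ 2 + 1 :
      Polynomial K).degree = 8 := by compute_degree!
    rw [this]
    norm_num)
  have hc : c ^ 8 + c ^ 4 + c ^ 3 + c ^ 2 + 1 = 0 := by simpa using hc
  have hpow : c ^ 256 = c := by
    rw [show 256 = 255 + 1 from rfl, pow_succ, ← orderOf_root hc, pow_orderOf_eq_one, one_mul]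
  have hsplit : (Polynomial.X ^ Fintype.card F - Polynomial.X : Polynomial F).Splits := by
    rw [Polynomial.splits_iff_card_roots, FiniteField.roots_X_pow_card_sub_X,
      FiniteField.X_pow_card_sub_X_natDegree_eq F Fintype.one_lt_card]
    rfl
  obtain ⟨a, rfl⟩ := hsplit.mem_range_of_isRoot (i := algebraMap F K) (x := c)
    (FiniteField.X_pow_card_sub_X_ne_zero F Fintype.one_lt_card) (by
      rw [← Nat.card_eq_fintype_card, hF]
      simp [hpow])
  refine ⟨a, (algebraMap F K).injective ?_⟩
  simpa using hc

end BinaryRoot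

theorem testBit_unroll (L : List ℕ) (t : ℕ) :
    (unroll L).testBit t = true ↔ ∃ l ∈ L, t = l ∨ t = l + 255 := by
  induction L with
  | nil => simp [unroll]
  | cons a L ih =>
    have h : unroll (a :: L) = unroll L ||| (2 ^ a ||| 2 ^ (a + 255)) := rfl
    rw [h, Nat.testBit_or, Nat.testBit_or, Nat.testBit_two_pow, Nat.testBit_two_pow]
    simp only [Bool.or_eq_true, ih, decide_eq_true_eq, List.mem_cons, exists_eq_or_imp]
    grind

theorem testBit_atLeast (D m k : ℕ) (L : List ℕ) :
    (atLeast D m L).testBit k = true ↔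
      k < 255 ∧ m ≤ L.countP fun l => D.testBit (l + k) := by
  induction L generalizing m with
  | nil =>
    cases m with
    | zero => rw [atLeast, Nat.testBit_two_pow_sub_one]; simp
    | succ m => simp [atLeast]
  | cons a L ih =>
    cases m with
    | zero => rw [atLeast, Nat.testBit_two_pow_sub_one]; simp
    | succ m =>
      simp only [atLeast, Nat.testBit_or, Nat.testBit_and, Nat.testBit_shiftRight,
        Bool.or_eq_true, Bool.and_eq_true, ih, List.countP_cons]
      split_ifs <;> grind

section CyclicShift

variable {K F : Type*} [Field K] [Field F] [Algebra K F]

theorem mem_cyclicShift {α : F} (hα : α ≠ 0) {V : Submodule K F} {y : F} :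
    y ∈ cyclicShift K F α V ↔ α⁻¹ * y ∈ V := by
  rw [cyclicShift, Submodule.mem_map]
  constructor
  · rintro ⟨x, hx, rfl⟩
    simpa [hα] using hx
  · exact fun h => ⟨_, h, by simp [hα]⟩

theorem cyclicShift_mul (α β : F) (V : Submodule K F) :
    cyclicShift K F (α * β) V = cyclicShift K F α (cyclicShift K F β V) := by
  simp [cyclicShift, LinearMap.mulLeft_mul, Submodule.map_comp]

theorem cyclicShift_one (V : Submodule K F) : cyclicShift K F 1 V = V := by
  ext y
  simp [mem_cyclicShift]

theorem cyclicShift_inf {α : F} (hα : α ≠ 0) (V W : Submodule K F) :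
    cyclicShift K F α (V ⊓ W) = cyclicShift K F α V ⊓ cyclicShift K F α W := by
  ext y
  simp [mem_cyclicShift hα]

theorem finrank_cyclicShift {α : F} (hα : α ≠ 0) (V : Submodule K F) :
    finrank K (cyclicShift K F α V) = finrank K V :=
  (Submodule.equivMapOfInjective (LinearMap.mulLeft K α)
    (mul_right_injective₀ hα) V).finrank_eq.symm

theorem mem_orbitOf_self (V : Submodule K F) : V ∈ orbitOf K F V :=
  ⟨1, one_ne_zero, (cyclicShift_one V).symm⟩

theorem cyclicShift_mem_orbitOf {α : F} (hα : α ≠ 0) {V W : Submodule K F}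
    (hW : W ∈ orbitOf K F V) : cyclicShift K F α W ∈ orbitOf K F V := by
  obtain ⟨β, hβ, rfl⟩ := hW
  exact ⟨α * β, mul_ne_zero hα hβ, (cyclicShift_mul _ _ _).symm⟩

theorem mem_orbitOf_symm {V W : Submodule K F} (hW : W ∈ orbitOf K F V) :
    V ∈ orbitOf K F W := by
  obtain ⟨β, hβ, rfl⟩ := hW
  exact ⟨β⁻¹, inv_ne_zero hβ, by rw [← cyclicShift_mul, inv_mul_cancel₀ hβ, cyclicShift_one]⟩

theorem orbitOf_subset {V W : Submodule K F} (hW : W ∈ orbitOf K F V) :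
    orbitOf K F W ⊆ orbitOf K F V := by
  rintro _ ⟨α, hα, rfl⟩
  exact cyclicShift_mem_orbitOf hα hW

theorem orbitOf_eq {V W : Submodule K F} (hW : W ∈ orbitOf K F V) :
    orbitOf K F W = orbitOf K F V :=
  (orbitOf_subset hW).antisymm (orbitOf_subset (mem_orbitOf_symm hW))

end CyclicShift

section Code

variable {F : Type*} [Field F] [Algebra (ZMod 2) F] {b : F}

/-- The representative of the `i`-th orbit. -/
def codeSpace (b : F) (i : Fin 20) : Submodule (ZMod 2) F :=
  Submodule.span (ZMod 2) {y | ∃ l ∈ codeLogs i, b ^ l = y}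

theorem charP_two_of_algebra (F : Type*) [Field F] [Algebra (ZMod 2) F] : CharP F 2 :=
  charP_of_injective_algebraMap (algebraMap (ZMod 2) F).injective 2

theorem mem_codeSpace (hb : b ^ 8 + b ^ 4 + b ^ 3 + b ^ 2 + 1 = 0) {i : Fin 20} {y : F} :
    y ∈ codeSpace b i ↔ y = 0 ∨ ∃ l ∈ codeLogs i, b ^ l = y := by
  have := charP_two_of_algebra F
  constructor
  · intro h
    induction h using Submodule.span_induction with
    | mem x hx => exact Or.inr hx
    | zero => exact Or.inl rfl
    | add x y _ _ hx hy =>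
      obtain rfl | ⟨l, hl, rfl⟩ := hx
      · simpa using hy
      obtain rfl | ⟨m, hm, rfl⟩ := hy
      · exact Or.inr ⟨l, hl, by simp⟩
      obtain h | ⟨k, hk, h⟩ := codeLogs_add i l hl m hm
      · left
        rw [← bitEval_powX hb, ← bitEval_powX hb, ← bitEval_xor, h]
        simp [bitEval]
      · exact Or.inr ⟨k, hk, (pow_add_pow_eq_of_powX_xor hb h).symm⟩
    | smul a x _ hx =>
      obtain rfl | rfl : a = 0 ∨ a = 1 := by revert a; decide
      · simp
      · simpa using hx
  · rintro (rfl | h)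
    · exact zero_mem _
    · exact Submodule.subset_span h

theorem eq_of_pow_eq_of_root (hb : b ^ 8 + b ^ 4 + b ^ 3 + b ^ 2 + 1 = 0) {k l : ℕ}
    (hk : k < 255) (hl : l < 255) (h : b ^ k = b ^ l) : k = l := by
  have := charP_two_of_algebra F
  refine pow_injOn_Iio_orderOf (x := b) ?_ ?_ h <;> simpa [orderOf_root hb]

theorem finrank_codeSpace [Finite F] (hb : b ^ 8 + b ^ 4 + b ^ 3 + b ^ 2 + 1 = 0) (i : Fin 20) :
    finrank (ZMod 2) (codeSpace b i) = 4 := by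
  classical
  have hcoe : (codeSpace b i : Set F) =
      (insert 0 ((codeLogs i).toFinset.image (b ^ ·)) : Finset F) := by
    ext y
    simp [mem_codeSpace hb]
  have hcard : Nat.card (codeSpace b i) = 16 := by
    have h : Nat.card (codeSpace b i) = (codeSpace b i : Set F).ncard := rfl
    rw [h, hcoe, Set.ncard_coe_finset, Finset.card_insert_of_notMem,
      Finset.card_image_of_injOn, List.toFinset_card_of_nodup (codeLogs_nodup i),
      codeLogs_length]
    · intro k hk l hl h
      simp only [List.coe_toFinset, Set.mem_ofPred_eq] at hk hl
      exact eq_of_pow_eq_of_root hb (codeLogs_lt i k hk) (codeLogs_lt i l hl) h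
    · simp [ne_zero_of_root hb]
  rw [Module.natCard_eq_pow_finrank (K := ZMod 2), Nat.card_zmod] at hcard
  exact Nat.pow_right_injective le_rfl hcard

theorem cyclicShift_codePeriod [Finite F] (hb : b ^ 8 + b ^ 4 + b ^ 3 + b ^ 2 + 1 = 0)
    (i : Fin 20) : cyclicShift (ZMod 2) F (b ^ codePeriod i) (codeSpace b i) = codeSpace b i := by
  have := charP_two_of_algebra F
  refine Submodule.eq_of_le_of_finrank_eq ?_
    (finrank_cyclicShift (pow_ne_zero _ (ne_zero_of_root hb)) _)
  rintro _ ⟨x, hx, rfl⟩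
  obtain rfl | ⟨l, hl, rfl⟩ := (mem_codeSpace hb).1 hx
  · simp
  · refine (mem_codeSpace hb).2 (Or.inr ⟨_, codeLogs_periodic i l hl, ?_⟩)
    rw [← orderOf_root hb, pow_mod_orderOf, add_comm, pow_add, LinearMap.mulLeft_apply]

theorem cyclicShift_of_codePeriod_dvd [Finite F] (hb : b ^ 8 + b ^ 4 + b ^ 3 + b ^ 2 + 1 = 0)
    {i : Fin 20} {m : ℕ} (h : codePeriod i ∣ m) :
    cyclicShift (ZMod 2) F (b ^ m) (codeSpace b i) = codeSpace b i := by
  obtain ⟨k, rfl⟩ := h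
  induction k with
  | zero => simp [cyclicShift_one]
  | succ k ih => rw [Nat.mul_succ, pow_add, cyclicShift_mul, cyclicShift_codePeriod hb, ih]

theorem finrank_cyclicShift_inf_le [Finite F] (hb : b ^ 8 + b ^ 4 + b ^ 3 + b ^ 2 + 1 = 0)
    {i j : Fin 20} {m : ℕ} (hm : m < 255) (h : ¬ (i = j ∧ codePeriod i ∣ m)) :
    finrank (ZMod 2) ↥(cyclicShift (ZMod 2) F (b ^ m) (codeSpace b i) ⊓ codeSpace b j) ≤ 2 := by
  classical
  have := charP_two_of_algebra F
  have hb0 := ne_zero_of_root hb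
  set T := cyclicShift (ZMod 2) F (b ^ m) (codeSpace b i) ⊓ codeSpace b j with hT
  let p : ℕ → Bool := fun l => (unroll (codeLogs j)).testBit (l + m)
  have hcount : (codeLogs i).countP p < 4 := by
    by_contra hge
    have hbit := (testBit_atLeast (unroll (codeLogs j)) 4 m (codeLogs i)).2 ⟨hm, not_lt.1 hge⟩
    rw [codeLogs_overlap] at hbit
    split_ifs at hbit with hij
    · exact h ⟨hij, dvd_of_testBit_periodMask i m hm hbit⟩
    · simp at hbit
  have hsub : (T : Set F) ⊆
      (insert 0 (((codeLogs i).filter p).map fun l => b ^ (l + m)).toFinset : Finset F) := by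
    rintro y ⟨⟨x, hx, rfl⟩, hy⟩
    obtain rfl | ⟨l, hl, rfl⟩ := (mem_codeSpace hb).1 hx
    · simp
    rw [LinearMap.mulLeft_apply, ← pow_add, add_comm m l] at hy ⊢
    refine Finset.mem_insert_of_mem (List.mem_toFinset.2 (List.mem_map_of_mem
      (List.mem_filter.2 ⟨hl, (testBit_unroll _ _).2 ?_⟩)))
    obtain h0 | ⟨k, hk, hkl⟩ := (mem_codeSpace hb).1 hy
    · exact absurd h0 (pow_ne_zero _ hb0)
    · refine ⟨k, hk, ?_⟩
      rw [← pow_mod_orderOf b (l + m), orderOf_root hb] at hkl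
      have hmod := eq_of_pow_eq_of_root hb (codeLogs_lt j k hk) (Nat.mod_lt _ (by norm_num)) hkl
      have := codeLogs_lt i l hl
      have := codeLogs_lt j k hk
      omega
  have hcard : Nat.card T ≤ 4 := by
    have h1 : (T : Set F).ncard ≤ _ := Set.ncard_le_ncard hsub
    rw [Set.ncard_coe_finset] at h1
    refine h1.trans ((Finset.card_insert_le _ _).trans (Nat.succ_le_succ ?_))
    refine (List.toFinset_card_le _).trans ?_
    rw [List.length_map, ← List.countP_eq_length_filter]
    omega
  rw [Module.natCard_eq_pow_finrank (K := ZMod 2), Nat.card_zmod] at hcard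
  exact (Nat.pow_le_pow_iff_right (le_refl 2)).1 hcard

theorem eq_and_dvd_of_cyclicShift_eq [Finite F] (hb : b ^ 8 + b ^ 4 + b ^ 3 + b ^ 2 + 1 = 0)
    {i j : Fin 20} {m : ℕ} (hm : m < 255)
    (h : cyclicShift (ZMod 2) F (b ^ m) (codeSpace b i) = codeSpace b j) :
    i = j ∧ codePeriod i ∣ m := by
  by_contra hne
  have := finrank_cyclicShift_inf_le hb hm hne
  rw [h, inf_idem, finrank_codeSpace hb] at this
  omega

theorem mem_orbitOf_codeSpace [Finite F] (hF : Nat.card F = 256)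
    (hb : b ^ 8 + b ^ 4 + b ^ 3 + b ^ 2 + 1 = 0) {i : Fin 20} {W : Submodule (ZMod 2) F} :
    W ∈ orbitOf (ZMod 2) F (codeSpace b i) ↔
      ∃ m < codePeriod i, cyclicShift (ZMod 2) F (b ^ m) (codeSpace b i) = W := by
  have := charP_two_of_algebra F
  constructor
  · rintro ⟨α, hα, rfl⟩
    obtain ⟨m, -, rfl⟩ := exists_pow_eq_of_root hF hb hα
    refine ⟨m % codePeriod i, Nat.mod_lt _ (by unfold codePeriod; split_ifs <;> norm_num), ?_⟩
    conv_rhs => rw [← Nat.mod_add_div m (codePeriod i), pow_add, cyclicShift_mul,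
      cyclicShift_of_codePeriod_dvd hb (Dvd.intro _ rfl)]
  · rintro ⟨m, -, rfl⟩
    exact ⟨b ^ m, pow_ne_zero _ (ne_zero_of_root hb), rfl⟩

theorem codePeriod_le (i : Fin 20) : codePeriod i ≤ 255 := by
  unfold codePeriod
  split_ifs <;> norm_num

theorem ncard_orbitOf_codeSpace [Finite F] (hF : Nat.card F = 256)
    (hb : b ^ 8 + b ^ 4 + b ^ 3 + b ^ 2 + 1 = 0) (i : Fin 20) :
    (orbitOf (ZMod 2) F (codeSpace b i)).ncard = codePeriod i := by
  have himage : orbitOf (ZMod 2) F (codeSpace b i) =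
      (fun m => cyclicShift (ZMod 2) F (b ^ m) (codeSpace b i)) '' Set.Iio (codePeriod i) := by
    ext W
    simp [mem_orbitOf_codeSpace hF hb]
  have hinj : Set.InjOn (fun m => cyclicShift (ZMod 2) F (b ^ m) (codeSpace b i))
      (Set.Iio (codePeriod i)) := by
    have aux : ∀ m n, m ≤ n → n < codePeriod i →
        cyclicShift (ZMod 2) F (b ^ m) (codeSpace b i) =
          cyclicShift (ZMod 2) F (b ^ n) (codeSpace b i) → m = n := by
      intro m n hmn hn h
      obtain ⟨k, rfl⟩ := Nat.exists_eq_add_of_le hmn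
      have hm0 : b ^ m ≠ 0 := pow_ne_zero _ (ne_zero_of_root hb)
      have h' := congrArg (cyclicShift (ZMod 2) F (b ^ m)⁻¹) h
      rw [pow_add, cyclicShift_mul (b ^ m), ← cyclicShift_mul, ← cyclicShift_mul,
        inv_mul_cancel₀ hm0, cyclicShift_one, cyclicShift_one] at h'
      have hlt : k < codePeriod i := by omega
      have hdvd := (eq_and_dvd_of_cyclicShift_eq hb (hlt.trans_le (codePeriod_le i)) h'.symm).2
      rw [Nat.eq_zero_of_dvd_of_lt hdvd hlt, add_zero]
    intro m hm n hn h
    rcases le_total m n with hmn | hmn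
    · exact aux m n hmn hn h
    · exact (aux n m hmn hm h.symm).symm
  rw [himage, hinj.ncard_image, Set.ncard_Iio_nat]

theorem eq_of_mem_orbitOf_codeSpace [Finite F] (hF : Nat.card F = 256)
    (hb : b ^ 8 + b ^ 4 + b ^ 3 + b ^ 2 + 1 = 0) {i j : Fin 20}
    (h : codeSpace b j ∈ orbitOf (ZMod 2) F (codeSpace b i)) : i = j := by
  obtain ⟨m, hm, h⟩ := (mem_orbitOf_codeSpace hF hb).1 h
  exact (eq_and_dvd_of_cyclicShift_eq hb (hm.trans_le (codePeriod_le i)) h).1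

theorem orbitOf_codeSpace_injective [Finite F] (hF : Nat.card F = 256)
    (hb : b ^ 8 + b ^ 4 + b ^ 3 + b ^ 2 + 1 = 0) :
    Function.Injective fun i => orbitOf (ZMod 2) F (codeSpace b i) := by
  intro i j h
  refine eq_of_mem_orbitOf_codeSpace hF hb ?_
  have h' : orbitOf (ZMod 2) F (codeSpace b i) = orbitOf (ZMod 2) F (codeSpace b j) := h
  rw [h']
  exact mem_orbitOf_self _

theorem isCyclicCode_iUnion_orbitOf [Finite F] (hF : Nat.card F = 256)
    (hb : b ^ 8 + b ^ 4 + b ^ 3 + b ^ 2 + 1 = 0) :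
    IsCyclicCode (ZMod 2) F 4 4 (⋃ i, orbitOf (ZMod 2) F (codeSpace b i)) := by
  have := charP_two_of_algebra F
  refine ⟨?_, ?_, ?_⟩
  · intro U hU
    obtain ⟨i, α, hα, rfl⟩ := Set.mem_iUnion.1 hU
    rw [finrank_cyclicShift hα, finrank_codeSpace hb]
  · intro α hα U hU
    obtain ⟨i, hi⟩ := Set.mem_iUnion.1 hU
    exact Set.mem_iUnion.2 ⟨i, cyclicShift_mem_orbitOf hα hi⟩
  · intro U hU W hW hne
    obtain ⟨i, α, hα, rfl⟩ := Set.mem_iUnion.1 hU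
    obtain ⟨j, β, hβ, rfl⟩ := Set.mem_iUnion.1 hW
    obtain ⟨m, hm, hmα⟩ := exists_pow_eq_of_root hF hb (mul_ne_zero (inv_ne_zero hβ) hα)
    have hα' : α = β * b ^ m := by rw [hmα, mul_inv_cancel_left₀ hβ]
    subst hα'
    rw [cyclicShift_mul] at hne ⊢
    have hcond : ¬ (i = j ∧ codePeriod i ∣ m) := by
      rintro ⟨rfl, hdvd⟩
      exact hne (by rw [cyclicShift_of_codePeriod_dvd hb hdvd])
    have hle := finrank_cyclicShift_inf_le hb hm hcond
    rw [subspaceDist, ← cyclicShift_inf hβ, finrank_cyclicShift hβ, finrank_cyclicShift hβ,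
      finrank_cyclicShift hβ, finrank_cyclicShift (pow_ne_zero _ (ne_zero_of_root hb)),
      finrank_codeSpace hb, finrank_codeSpace hb]
    omega

theorem orbitsOf_iUnion_orbitOf {K F ι : Type*} [Field K] [Field F] [Algebra K F]
    (V : ι → Submodule K F) :
    orbitsOf K F (⋃ i, orbitOf K F (V i)) = Set.range fun i => orbitOf K F (V i) := by
  ext O
  constructor
  · rintro ⟨W, hW, rfl⟩
    obtain ⟨i, hi⟩ := Set.mem_iUnion.1 hW
    exact ⟨i, (orbitOf_eq hi).symm⟩
  · rintro ⟨i, rfl⟩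
    exact ⟨V i, Set.mem_iUnion.2 ⟨i, mem_orbitOf_self _⟩, rfl⟩

theorem ncard_iUnion_orbitOf_codeSpace [Finite F] (hF : Nat.card F = 256)
    (hb : b ^ 8 + b ^ 4 + b ^ 3 + b ^ 2 + 1 = 0) :
    (⋃ i, orbitOf (ZMod 2) F (codeSpace b i)).ncard = 4420 := by
  rw [Set.ncard_iUnion_of_finite (fun i => Set.toFinite _), finsum_eq_sum_of_fintype]
  · simp only [ncard_orbitOf_codeSpace hF hb]
    decide +kernel
  · intro i j hij
    refine Set.disjoint_left.2 fun W hi hj => hij (orbitOf_codeSpace_injective hF hb ?_)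
    exact (orbitOf_eq hi).symm.trans (orbitOf_eq hj)

theorem ncard_orbitsOf_codePeriod [Finite F] (hF : Nat.card F = 256)
    (hb : b ^ 8 + b ^ 4 + b ^ 3 + b ^ 2 + 1 = 0) (d : ℕ) :
    {O ∈ orbitsOf (ZMod 2) F (⋃ i, orbitOf (ZMod 2) F (codeSpace b i)) | O.ncard = d}.ncard =
      (Finset.univ.filter fun i => codePeriod i = d).card := by
  have himage : {O ∈ orbitsOf (ZMod 2) F (⋃ i, orbitOf (ZMod 2) F (codeSpace b i)) |
      O.ncard = d} = (fun i => orbitOf (ZMod 2) F (codeSpace b i)) ''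
        (Finset.univ.filter fun i => codePeriod i = d : Finset (Fin 20)) := by
    ext O
    rw [orbitsOf_iUnion_orbitOf]
    constructor
    · rintro ⟨⟨i, rfl⟩, h⟩
      exact ⟨i, by simpa [ncard_orbitOf_codeSpace hF hb] using h, rfl⟩
    · rintro ⟨i, hi, rfl⟩
      exact ⟨⟨i, rfl⟩, by simpa [ncard_orbitOf_codeSpace hF hb] using hi⟩
  rw [himage, Set.ncard_image_of_injective _ (orbitOf_codeSpace_injective hF hb),
    Set.ncard_coe_finset]

end Code

/-- there is a cyclic code in G_2(8,4) with minimum subspace distance at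
least 4 and 4420 codewords, consisting of 16 orbits of cardinality 255 and 4 orbits of
cardinality 85. -/
theorem C2_8_4_4_exists_4420 :
    ∃ C : Set (Submodule (ZMod 2) (GaloisField 2 8)),
      IsCyclicCode (ZMod 2) (GaloisField 2 8) 4 4 C ∧ C.ncard = 4420 ∧
      {O ∈ orbitsOf (ZMod 2) (GaloisField 2 8) C | O.ncard = 255}.ncard = 16 ∧
      {O ∈ orbitsOf (ZMod 2) (GaloisField 2 8) C | O.ncard = 85}.ncard = 4 ∧
      (orbitsOf (ZMod 2) (GaloisField 2 8) C).ncard = 20 := by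
  have hF : Nat.card (GaloisField 2 8) = 256 := GaloisField.card 2 8 (by norm_num)
  obtain ⟨b, hb⟩ := exists_root_of_card hF
  refine ⟨⋃ i, orbitOf (ZMod 2) (GaloisField 2 8) (codeSpace b i),
    isCyclicCode_iUnion_orbitOf hF hb, ncard_iUnion_orbitOf_codeSpace hF hb, ?_, ?_, ?_⟩
  · rw [ncard_orbitsOf_codePeriod hF hb]
    decide +kernel
  · rw [ncard_orbitsOf_codePeriod hF hb]
    decide +kernel
  · rw [orbitsOf_iUnion_orbitOf, ← Set.image_univ,
      Set.ncard_image_of_injective _ (orbitOf_codeSpace_injective hF hb), Set.ncard_univ,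
      Nat.card_fin]
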